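/- Let G be a three-player LTL game (Ag = {1,2,3}) with empty strong core. Then there exists a strategy profile σ on G whose run ρ(σ) satisfies exactly two of the goals γ_1, γ_2, γ_3. -/

import Mathlib

/-- A concurrent game structure over a set of agents `Ag`, states `St`, and,
for each agent `i`, a set of actions `Ac i`.  It consists of an initial state
and a transition function. -/
structure CGS (Ag St : Type) (Ac : Ag → Type) where
  init : St
  tr : St → (∀ i, Ac i) → St

/-- A strategy for a player with actions `A`: it maps finite (nonempty)
histories of states, given as lists, to an action. -/
abbrev Strategy (St A : Type) := List St → A

/-- A strategy profile: one strategy for each player. -/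
abbrev Profile {Ag : Type} (St : Type) (Ac : Ag → Type) := ∀ i, Strategy St (Ac i)

namespace CGS

variable {Ag St : Type} {Ac : Ag → Type}

/-- The history `ρ(σ)[0 … t]` (as a list) together with the current state
`ρ(σ)[t]` of the run induced by a strategy profile `σ`. -/
def histRun (M : CGS Ag St Ac) (σ : Profile St Ac) : ℕ → List St × St
  | 0 => ([M.init], M.init)
  | t + 1 =>
      let p := histRun M σ t
      let s := M.tr p.2 (fun i => σ i p.1)
      (p.1 ++ [s], s)

/-- The unique run `ρ(σ)` induced by a strategy profile `σ`. -/
def run (M : CGS Ag St Ac) (σ : Profile St Ac) (t : ℕ) : St :=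
  (histRun M σ t).2

/-- A run of `M`: an infinite state sequence starting at the initial state in
which every step is obtained by some action profile. -/
def IsRun (M : CGS Ag St Ac) (ρ : ℕ → St) : Prop :=
  ρ 0 = M.init ∧ ∀ t, ∃ a : ∀ i, Ac i, ρ (t + 1) = M.tr (ρ t) a

end CGS

open Classical in
/-- Combine a joint strategy `σC` for a coalition `C` with strategies `σN`
for the players outside `C`, obtaining a full strategy profile. -/
noncomputable def combine {Ag St : Type} {Ac : Ag → Type} (C : Set Ag)
    (σC : ∀ i ∈ C, Strategy St (Ac i)) (σN : ∀ i ∉ C, Strategy St (Ac i)) :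
    Profile St Ac :=
  fun i => if h : i ∈ C then σC i h else σN i h

/-- Syntax of Linear Temporal Logic over atomic propositions `AP`:
atoms, negation, disjunction, next, and until. -/
inductive LTLFormula (AP : Type) where
  | atom : AP → LTLFormula AP
  | neg  : LTLFormula AP → LTLFormula AP
  | disj : LTLFormula AP → LTLFormula AP → LTLFormula AP
  | next : LTLFormula AP → LTLFormula AP
  | untl : LTLFormula AP → LTLFormula AP → LTLFormula AP

/-- Standard LTL semantics over infinite runs `ρ : ℕ → St`, via a labelling
function `lab : St → Set AP`. -/
def LTLFormula.Sat {AP St : Type} (lab : St → Set AP) :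
    LTLFormula AP → (ℕ → St) → Prop
  | .atom p, ρ => p ∈ lab (ρ 0)
  | .neg φ, ρ => ¬ LTLFormula.Sat lab φ ρ
  | .disj φ ψ, ρ => LTLFormula.Sat lab φ ρ ∨ LTLFormula.Sat lab ψ ρ
  | .next φ, ρ => LTLFormula.Sat lab φ (fun t => ρ (t + 1))
  | .untl φ ψ, ρ =>
      ∃ j : ℕ, LTLFormula.Sat lab ψ (fun t => ρ (t + j)) ∧
        ∀ k < j, LTLFormula.Sat lab φ (fun t => ρ (t + k))

/-- An LTL game: a concurrent game structure together with a labelling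
function and an LTL goal for each player. -/
structure LTLGame (Ag St : Type) (Ac : Ag → Type) (AP : Type) where
  M : CGS Ag St Ac
  lab : St → Set AP
  goal : Ag → LTLFormula AP

namespace LTLGame

variable {Ag St AP : Type} {Ac : Ag → Type}

/-- The winners of a run: players whose goal is satisfied by the run. -/
def winners (G : LTLGame Ag St Ac AP) (ρ : ℕ → St) : Set Ag :=
  {i | (G.goal i).Sat G.lab ρ}

/-- `σC` is a beneficial deviation for the (nonempty) coalition `C` from the
strategy profile `σ`: every member of `C` loses under `σ`, and all members of
`C` win under `(σC, σN)` no matter which joint strategy `σN` the remaining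
players use. -/
def BeneficialDeviation (G : LTLGame Ag St Ac AP) (C : Set Ag)
    (σ : Profile St Ac) (σC : ∀ i ∈ C, Strategy St (Ac i)) : Prop :=
  C.Nonempty ∧
  C ⊆ (G.winners (G.M.run σ))ᶜ ∧
  ∀ σN : ∀ i ∉ C, Strategy St (Ac i), C ⊆ G.winners (G.M.run (combine C σC σN))

/-- A strategy profile is in the core iff no coalition has a beneficial
deviation from it. -/
def inCore (G : LTLGame Ag St Ac AP) (σ : Profile St Ac) : Prop :=
  ∀ (C : Set Ag) (σC : ∀ i ∈ C, Strategy St (Ac i)),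
    ¬ G.BeneficialDeviation C σ σC

/-- A (nonempty) coalition `C` is fulfilled if it has a joint strategy
guaranteeing all goals of its members, against every joint strategy of the
remaining players. -/
def Fulfilled (G : LTLGame Ag St Ac AP) (C : Set Ag) : Prop :=
  C.Nonempty ∧
  ∃ σC : ∀ i ∈ C, Strategy St (Ac i),
    ∀ σN : ∀ i ∉ C, Strategy St (Ac i),
      C ⊆ G.winners (G.M.run (combine C σC σN))

/-- `σC` is a strong beneficial deviation for the (nonempty) coalition `C`
from `σ`: (1) all members of `C` lose under `σ`; (2) all members of `C` win
under `(σ₋C, σC)`; (3) against every counter joint strategy `σN` under which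
all original winners still win, all members of `C` win. -/
def StrongBeneficialDeviation (G : LTLGame Ag St Ac AP) (C : Set Ag)
    (σ : Profile St Ac) (σC : ∀ i ∈ C, Strategy St (Ac i)) : Prop :=
  C.Nonempty ∧
  C ⊆ (G.winners (G.M.run σ))ᶜ ∧
  C ⊆ G.winners (G.M.run (combine C σC (fun i _ => σ i))) ∧
  ∀ σN : ∀ i ∉ C, Strategy St (Ac i),
    G.winners (G.M.run σ) ⊆ G.winners (G.M.run (combine C σC σN)) →
      C ⊆ G.winners (G.M.run (combine C σC σN))

/-- A strategy profile is in the strong core iff no coalition has a strong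
beneficial deviation from it. -/
def inStrongCore (G : LTLGame Ag St Ac AP) (σ : Profile St Ac) : Prop :=
  ∀ (C : Set Ag) (σC : ∀ i ∈ C, Strategy St (Ac i)),
    ¬ G.StrongBeneficialDeviation C σ σC

/-- `(G, φ) ∈ E-Core` iff some member of the core of `G` induces a run
satisfying `φ`. -/
def ECore (G : LTLGame Ag St Ac AP) (φ : LTLFormula AP) : Prop :=
  ∃ σ : Profile St Ac, G.inCore σ ∧ φ.Sat G.lab (G.M.run σ)

end LTLGame

/-- In an outcome function `w` on three players in which no profile has two winners, some profile
admits no deviation by a single losing player that makes her win, both in place and against every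
counter-deviation preserving the original winners. -/
theorem not_forall_exists_single_deviation {X : Fin 3 → Type} [∀ i, Nonempty (X i)]
    (w : (∀ i, X i) → Set (Fin 3)) (hsub : ∀ σ, (w σ).Subsingleton) :
    ¬ ∀ σ, ∃ j x, j ∉ w σ ∧ j ∈ w (Function.update σ j x) ∧
      ∀ τ, τ j = x → w σ ⊆ w τ → j ∈ w τ := by
  intro hdev
  have hne : ∀ σ, (w σ).Nonempty := by
    intro σ
    by_contra h
    rw [Set.not_nonempty_iff_eq_empty] at h
    obtain ⟨j, x, -, -, hj⟩ := hdev σ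
    rw [h] at hj
    obtain ⟨k, y, hk, hk', -⟩ := hdev (Function.update σ j x)
    have hjk : j ≠ k := by
      rintro rfl
      exact hk (hj _ (by simp) (Set.empty_subset _))
    exact hjk (hsub _ (hj _ (by simp [hjk]) (Set.empty_subset _)) hk')
  -- a winner can be replaced by another player who forces her to lose
  have hblock : ∀ σ, ∀ i ∈ w σ, ∃ j ≠ i, ∃ x, j ∈ w (Function.update σ j x) ∧
      ∀ τ, τ j = x → i ∉ w τ := by
    intro σ i hi
    obtain ⟨j, x, hj, hj', h⟩ := hdev σ
    have hji : j ≠ i := fun e => hj (e ▸ hi)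
    refine ⟨j, hji, x, hj', fun τ hτ hiτ => hji (hsub τ (h τ hτ ?_) hiτ)⟩
    intro l hl
    rwa [hsub σ hl hi]
  -- two players cannot each force the other to lose
  have hcycle : ∀ i j : Fin 3, i ≠ j → (∃ x, ∀ τ, τ i = x → j ∉ w τ) →
      (∃ y, ∀ τ, τ j = y → i ∉ w τ) → False := by
    rintro i j hij ⟨x, hx⟩ ⟨y, hy⟩
    set σ : ∀ i, X i :=
      Function.update (Function.update (fun _ => Classical.arbitrary _) i x) j y with hσ
    have hσi : σ i = x := by simp [hσ, hij]
    have hσj : σ j = y := by simp [hσ]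
    obtain ⟨k, hk⟩ := hne σ
    have hki : k ≠ i := fun e => hy σ hσj (e ▸ hk)
    have hkj : k ≠ j := fun e => hx σ hσi (e ▸ hk)
    obtain ⟨l, hl, z, hlz, -⟩ := hblock σ k hk
    have hlij : l = i ∨ l = j := by omega
    rcases hlij with rfl | rfl
    · exact hy _ (by simp [hij.symm, hσj]) hlz
    · exact hx _ (by simp [hij, hσi]) hlz
  obtain ⟨i, hi⟩ := hne (fun _ => Classical.arbitrary _)
  obtain ⟨j, hji, x, hj, hjx⟩ := hblock _ i hi
  obtain ⟨k, hkj, y, hk, hky⟩ := hblock _ j hj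
  obtain ⟨l, hlk, z, -, hlz⟩ := hblock _ k hk
  have hki : k ≠ i := by
    rintro rfl
    exact hcycle _ _ hkj ⟨y, hky⟩ ⟨x, hjx⟩
  have hlj : l ≠ j := by
    rintro rfl
    exact hcycle _ _ hlk ⟨z, hlz⟩ ⟨y, hky⟩
  obtain rfl : l = i := by omega
  set σ : ∀ i, X i := Function.update (Function.update (Function.update
    (fun _ => Classical.arbitrary _) j x) k y) l z with hσ
  obtain ⟨m, hm⟩ := hne σ
  have hml : m ≠ l := fun e => hjx σ (by simp [hσ, hji, hkj.symm]) (e ▸ hm)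
  have hmj : m ≠ j := fun e => hky σ (by simp [hσ, hki]) (e ▸ hm)
  have hmk : m ≠ k := fun e => hlz σ (by simp [hσ]) (e ▸ hm)
  omega

/-- Let `G` be a three-player LTL game with empty strong core.
Then there exists a strategy profile `σ` whose run satisfies exactly two of
the goals, i.e. the winner set of `ρ(σ)` has exactly two elements. -/
theorem exists_profile_with_exactly_two_winners_of_empty_strongCore
    {St AP : Type} {Ac : Fin 3 → Type}
    [Fintype St] [∀ i, Fintype (Ac i)] [∀ i, Nonempty (Ac i)] [Fintype AP]
    (G : LTLGame (Fin 3) St Ac AP)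
    (hempty : ∀ σ : Profile St Ac,
      ∃ (C : Set (Fin 3)) (σC : ∀ i ∈ C, Strategy St (Ac i)),
        G.StrongBeneficialDeviation C σ σC) :
    ∃ σ : Profile St Ac, (G.winners (G.M.run σ)).ncard = 2 := by
  by_contra! htwo
  have hsub : ∀ σ, (G.winners (G.M.run σ)).Subsingleton := by
    intro σ
    obtain ⟨C, -, ⟨c, hc⟩, hCσ, -⟩ := hempty σ
    have hlt : (G.winners (G.M.run σ)).ncard < 3 := by
      have h := Set.ncard_lt_card (s := G.winners (G.M.run σ))
        (fun e => hCσ hc (e ▸ Set.mem_univ c))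
      simpa using h
    rw [← Set.ncard_le_one_iff_subsingleton]
    have := htwo σ
    omega
  refine not_forall_exists_single_deviation (fun σ => G.winners (G.M.run σ)) hsub fun σ => ?_
  obtain ⟨C, σC, ⟨j, hj⟩, hlose, hwin, hcounter⟩ := hempty σ
  obtain rfl : C = {j} :=
    (Set.Subsingleton.anti (hsub _) hwin).eq_singleton_of_mem hj
  have hcombine : ∀ τ : Profile St Ac,
      combine {j} σC (fun i _ => τ i) = Function.update τ j (σC j hj) := by
    intro τ
    funext i
    by_cases h : i = j
    · subst h
      simp [combine]
    · simp [combine, h]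
  refine ⟨j, σC j hj, hlose hj, ?_, fun τ hτ hsubset => ?_⟩
  · rw [← hcombine]
    exact hwin hj
  · have h := hcounter fun i _ => τ i
    rw [hcombine, ← hτ, Function.update_eq_self] at h
    exact h hsubset hj
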